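/- arXiv:1912.09906 — 5 statements merged into one kernel-verified Lean document; each statement's English description precedes it below -/
import Mathlib

section
/- Let d ≥ 1, let K be a finite index type, and for each k ∈ K let p_k : Matrix (Fin d) (Fin d) ℂ → ℂ be a ℂ-linear functional. Assume that for every density matrix ρ the value p_k(ρ) is a nonnegative real number for each k, and that Σ_{k∈K} p_k(ρ) = 1 for every density matrix ρ. Then there exists a unique family (P_k)_{k∈K} of d×d complex matrices such that each P_k is Hermitian and positive semidefinite, Σ_{k∈K} P_k = 1 (the identity matrix), and p_k(ρ) = Tr(ρ·P_k) for every density matrix ρ and every k ∈ K. -/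
open Matrix BigOperators
open scoped ComplexOrder

lemma aux_zero {d : ℕ} (M : Matrix (Fin d) (Fin d) ℂ)
    (h : ∀ x : Fin d → ℂ, star x ⬝ᵥ (M *ᵥ x) = 0) : M = 0 := by
  have h2 : Matrix.toEuclideanLin M = 0 := by
    rw [← inner_map_self_eq_zero]
    intro x
    have h3 := h (WithLp.ofLp x)
    rw [← inner_conj_symm, EuclideanSpace.inner_eq_star_dotProduct, dotProduct_comm]
    simpa [Matrix.toLpLin_apply] using h3
  exact (LinearEquiv.map_eq_zero_iff _).1 h2

lemma aux_trace {d : ℕ} (M : Matrix (Fin d) (Fin d) ℂ) (x : Fin d → ℂ) :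
    (vecMulVec x (star x) * M).trace = star x ⬝ᵥ (M *ᵥ x) := by
  rw [vecMulVec_mul, trace_vecMulVec, dotProduct_comm, ← dotProduct_mulVec]

/-- Every nonzero vector gives, after normalisation, a density matrix. -/
lemma aux_density {d : ℕ} (x : Fin d → ℂ) (hx : x ≠ 0) :
    ∃ (c : ℂ) (ρ : Matrix (Fin d) (Fin d) ℂ), 0 ≤ c ∧ ρ.PosSemidef ∧ ρ.trace = 1 ∧
      vecMulVec x (star x) = c • ρ := by
  have h0 : x ⬝ᵥ star x ≠ 0 := fun h => hx (dotProduct_star_self_eq_zero.1 ((dotProduct_comm _ _).trans h))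
  have h1 : 0 ≤ x ⬝ᵥ star x := by
    rw [dotProduct_comm]; exact dotProduct_star_self_nonneg x
  refine ⟨x ⬝ᵥ star x, (x ⬝ᵥ star x)⁻¹ • vecMulVec x (star x), h1, ?_, ?_, ?_⟩
  · exact (posSemidef_vecMulVec_self_star x).smul (inv_nonneg.2 h1)
  · rw [trace_smul, trace_vecMulVec, smul_eq_mul, inv_mul_cancel₀ h0]
  · rw [smul_smul, mul_inv_cancel₀ h0, one_smul]

lemma aux_quad {d : ℕ} (M : Matrix (Fin d) (Fin d) ℂ)
    (h : ∀ ρ : Matrix (Fin d) (Fin d) ℂ, ρ.PosSemidef → ρ.trace = 1 → (ρ * M).trace = 0) :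
    M = 0 := by
  apply aux_zero
  intro x
  by_cases hx : x = 0
  · simp [hx]
  · obtain ⟨c, ρ, -, h1, h2, h3⟩ := aux_density x hx
    rw [← aux_trace, h3, smul_mul, trace_smul, h ρ h1 h2, smul_zero]

lemma aux_pos {d : ℕ} (M : Matrix (Fin d) (Fin d) ℂ)
    (h : ∀ ρ : Matrix (Fin d) (Fin d) ℂ, ρ.PosSemidef → ρ.trace = 1 → 0 ≤ (ρ * M).trace) :
    M.PosSemidef := by
  have hq : ∀ x : Fin d → ℂ, 0 ≤ star x ⬝ᵥ (M *ᵥ x) := by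
    intro x
    by_cases hx : x = 0
    · simp [hx]
    · obtain ⟨c, ρ, hc, h1, h2, h3⟩ := aux_density x hx
      rw [← aux_trace, h3, smul_mul, trace_smul]
      exact mul_nonneg hc (h ρ h1 h2)
  refine PosSemidef.of_dotProduct_mulVec_nonneg ?_ hq
  have : Mᴴ - M = 0 := by
    apply aux_zero
    intro x
    have h1 : star (star x ⬝ᵥ (M *ᵥ x)) = star x ⬝ᵥ (M *ᵥ x) :=
      (IsSelfAdjoint.of_nonneg (hq x)).star_eq
    have h2 : star (star x ⬝ᵥ (M *ᵥ x)) = star x ⬝ᵥ (Mᴴ *ᵥ x) := by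
      rw [star_dotProduct, star_star, star_mulVec, ← dotProduct_mulVec]
    rw [sub_mulVec, dotProduct_sub, ← h2, h1, sub_self]
  exact sub_eq_zero.1 this

lemma aux_repr {d : ℕ} (f : Matrix (Fin d) (Fin d) ℂ →ₗ[ℂ] ℂ) (A : Matrix (Fin d) (Fin d) ℂ) :
    f A = (A * Matrix.of fun i j => f (single j i 1)).trace := by
  conv_lhs => rw [matrix_eq_sum_single A]
  simp only [map_sum, trace, diag_apply, mul_apply, of_apply]
  refine Finset.sum_congr rfl fun i _ => Finset.sum_congr rfl fun j _ => ?_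
  rw [← smul_eq_mul, ← map_smul, smul_single, smul_eq_mul, mul_one]


/-- A family of linear detector response functionals that is nonnegative
on density matrices and sums to 1 on every density matrix is given by a unique
discrete POVM via the trace formula. -/
theorem detector_response_povm {d : ℕ} (hd : 1 ≤ d) {K : Type*} [Fintype K]
    (p : K → (Matrix (Fin d) (Fin d) ℂ →ₗ[ℂ] ℂ))
    (hpos : ∀ ρ : Matrix (Fin d) (Fin d) ℂ, ρ.PosSemidef → ρ.trace = 1 →
      ∀ k : K, 0 ≤ (p k ρ).re ∧ (p k ρ).im = 0)
    (hsum : ∀ ρ : Matrix (Fin d) (Fin d) ℂ, ρ.PosSemidef → ρ.trace = 1 →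
      ∑ k : K, p k ρ = 1) :
    ∃! P : K → Matrix (Fin d) (Fin d) ℂ,
      (∀ k : K, (P k).IsHermitian ∧ (P k).PosSemidef) ∧
      (∑ k : K, P k = 1) ∧
      (∀ ρ : Matrix (Fin d) (Fin d) ℂ, ρ.PosSemidef → ρ.trace = 1 →
        ∀ k : K, p k ρ = (ρ * P k).trace) := by
  have hrepr := fun k A => aux_repr (p k) A
  set P : K → Matrix (Fin d) (Fin d) ℂ :=
    fun k => Matrix.of fun i j => p k (single j i 1) with hP
  refine ⟨P, ⟨fun k => ?_, ?_, fun ρ _ _ k => hrepr k ρ⟩, ?_⟩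
  · have : (P k).PosSemidef := by
      apply aux_pos
      intro ρ h1 h2
      have h3 := hpos ρ h1 h2 k
      have h4 : p k ρ = (ρ * P k).trace := hrepr k ρ
      rw [← h4, Complex.nonneg_iff]
      exact ⟨h3.1, h3.2.symm⟩
    exact ⟨this.isHermitian, this⟩
  · rw [← sub_eq_zero]
    apply aux_quad
    intro ρ h1 h2
    have h3 := hsum ρ h1 h2
    have h4 : ∀ k, p k ρ = (ρ * P k).trace := fun k => hrepr k ρ
    simp only [h4] at h3
    rw [mul_sub, trace_sub, Finset.mul_sum, trace_sum, h3, mul_one, h2, sub_self]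
  · rintro Q ⟨-, -, hQ⟩
    funext k
    rw [← sub_eq_zero]
    apply aux_quad
    intro ρ h1 h2
    have h4 : p k ρ = (ρ * P k).trace := hrepr k ρ
    rw [mul_sub, trace_sub, ← hQ ρ h1 h2 k, ← h4, sub_self]
end

section
/- Let (P_k)_{k∈K} be a discrete POVM of d×d complex matrices, let m ≥ 1, let a : K → ℂ^m be a scale, and define A_j := Σ_{k∈K} (a_k)_j·P_k for j = 1,…,m. Let G be a Hermitian positive semidefinite m×m complex matrix. Then the d×d matrix Σ_{k∈K} (Σ_{i,j} conj((a_k)_i)·G_{ij}·(a_k)_j)·P_k − Σ_{i,j} G_{ij}·A_iᴴ·A_j is positive semidefinite. -/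
open Matrix BigOperators
open scoped ComplexOrder

/-- Scalar case. -/
lemma povm_scalar_defect {d : ℕ} {K : Type*} [Fintype K]
    (P : K → Matrix (Fin d) (Fin d) ℂ)
    (hP : ∀ k, (P k).PosSemidef) (hP1 : ∑ k, P k = 1) (b : K → ℂ)
    (C : Matrix (Fin d) (Fin d) ℂ) (hC : C = ∑ k, b k • P k) :
    (∑ k, (star (b k) * b k) • P k - Cᴴ * C).PosSemidef := by
  have hCH : Cᴴ = ∑ k, star (b k) • P k := by
    rw [hC, conjTranspose_sum]
    refine Finset.sum_congr rfl fun k _ => ?_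
    rw [conjTranspose_smul, (hP k).1.eq]
  have key : ∑ k, (star (b k) * b k) • P k - Cᴴ * C
      = ∑ k, (b k • (1 : Matrix (Fin d) (Fin d) ℂ) - C)ᴴ * P k * (b k • 1 - C) := by
    have h1 : ∀ k, (b k • (1 : Matrix (Fin d) (Fin d) ℂ) - C)ᴴ * P k * (b k • 1 - C)
        = (star (b k) * b k) • P k - (star (b k) • P k) * C - Cᴴ * (b k • P k)
          + Cᴴ * P k * C := by
      intro k
      simp only [conjTranspose_sub, conjTranspose_smul, conjTranspose_one, sub_mul, mul_sub,
        smul_mul_assoc, mul_smul_comm, one_mul, mul_one, smul_sub, smul_smul,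
        mul_comm (b k)]
      abel
    simp only [h1, Finset.sum_add_distrib, Finset.sum_sub_distrib, ← Finset.sum_mul,
      ← Finset.mul_sum, hP1, ← hC, ← hCH, mul_one]
    abel
  rw [key]
  exact Matrix.posSemidef_sum _ fun k _ => (hP k).conjTranspose_mul_mul_same _

/-- For a discrete POVM (P_k), a scale a : K → ℂ^m with measured
quantity A_j = Σ_k (a_k)_j P_k, and a Hermitian PSD m×m matrix G, the matrix
Σ_k (a_k^*·G·a_k)·P_k − Σ_{i,j} G_{ij}·A_iᴴ·A_j is positive semidefinite. -/
theorem povm_quadratic_defect_psd {d : ℕ} {K : Type*} [Fintype K]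
    (P : K → Matrix (Fin d) (Fin d) ℂ)
    (hP : ∀ k, (P k).PosSemidef) (hP1 : ∑ k, P k = 1)
    {m : ℕ} (hm : 1 ≤ m) (a : K → Fin m → ℂ)
    (A : Fin m → Matrix (Fin d) (Fin d) ℂ)
    (hA : ∀ j, A j = ∑ k, a k j • P k)
    (G : Matrix (Fin m) (Fin m) ℂ) (hG : G.PosSemidef) :
    (∑ k, (∑ i, ∑ j, (starRingEnd ℂ) (a k i) * G i j * a k j) • P k
      - ∑ i, ∑ j, G i j • ((A i)ᴴ * A j)).PosSemidef := by
  obtain ⟨B, hB⟩ : ∃ B : Matrix (Fin m) (Fin m) ℂ, G = Bᴴ * B := by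
    open scoped MatrixOrder in
    exact CStarAlgebra.nonneg_iff_eq_star_mul_self.mp hG.nonneg
  have hGij : ∀ i j, G i j = ∑ l, star (B l i) * B l j := by
    intro i j
    rw [hB, Matrix.mul_apply]
    rfl
  have e1 : ∀ k, (∑ i, ∑ j, (starRingEnd ℂ) (a k i) * G i j * a k j)
      = ∑ l, star (∑ j, B l j * a k j) * (∑ j, B l j * a k j) := by
    intro k
    rw [Finset.sum_comm]
    simp only [hGij, star_sum, Finset.mul_sum, Finset.sum_mul]
    conv_rhs => rw [Finset.sum_comm]
    refine Finset.sum_congr rfl fun i _ => ?_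
    rw [Finset.sum_comm]
    refine Finset.sum_congr rfl fun l _ => Finset.sum_congr rfl fun j _ => ?_
    rw [star_mul, starRingEnd_apply]
    ring
  have e2 : ∑ i, ∑ j, G i j • ((A i)ᴴ * A j)
      = ∑ l, (∑ j, B l j • A j)ᴴ * (∑ j, B l j • A j) := by
    simp only [hGij, conjTranspose_sum, Finset.sum_mul_sum, Finset.sum_smul,
      conjTranspose_smul, smul_mul_assoc, mul_smul_comm, smul_smul]
    conv_rhs => rw [Finset.sum_comm]
    refine Finset.sum_congr rfl fun i _ => ?_
    rw [Finset.sum_comm]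
    refine Finset.sum_congr rfl fun l _ => Finset.sum_congr rfl fun j _ => ?_
    rw [mul_comm]
  have e3 : ∑ k, (∑ i, ∑ j, (starRingEnd ℂ) (a k i) * G i j * a k j) • P k
      - ∑ i, ∑ j, G i j • ((A i)ᴴ * A j)
      = ∑ l, (∑ k, (star (∑ j, B l j * a k j) * (∑ j, B l j * a k j)) • P k
        - (∑ j, B l j • A j)ᴴ * (∑ j, B l j • A j)) := by
    rw [e2, Finset.sum_sub_distrib]
    simp only [e1, Finset.sum_smul]
    rw [Finset.sum_comm]
  rw [e3]
  refine Matrix.posSemidef_sum _ fun l _ => povm_scalar_defect P hP hP1 _ _ ?_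
  simp only [hA, Finset.smul_sum, Finset.sum_smul, smul_smul]
  rw [Finset.sum_comm]
end

section
/- Let (P_k)_{k∈K} be a discrete POVM of d×d complex matrices, let m ≥ 1, let a : K → ℂ^m be a scale, define A_j := Σ_{k∈K} (a_k)_j·P_k, and let ρ be a density matrix. Then for every ξ ∈ ℂ^m, Σ_{k∈K} Tr(ρ·P_k)·‖a_k − ξ‖² ≥ Tr(ρ·Σ_j (A_j − ξ_j·1)ᴴ(A_j − ξ_j·1)), where both sides are real numbers. -/
open Matrix BigOperators
open scoped ComplexOrder

open scoped MatrixOrder Matrix.Norms.L2Operator in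
theorem trace_mul_nonneg_aux {d : ℕ} {ρ Q : Matrix (Fin d) (Fin d) ℂ}
    (hρ : ρ.PosSemidef) (hQ : Q.PosSemidef) : 0 ≤ (ρ * Q).trace := by
  obtain ⟨C, rfl⟩ := CStarAlgebra.nonneg_iff_eq_star_mul_self.mp hρ.nonneg
  rw [Matrix.star_eq_conjTranspose, Matrix.mul_assoc, Matrix.trace_mul_comm]
  exact (hQ.mul_mul_conjTranspose_same C).trace_nonneg

theorem kadison_aux {d : ℕ} {K : Type*} [Fintype K]
    (P : K → Matrix (Fin d) (Fin d) ℂ)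
    (hP : ∀ k, (P k).PosSemidef) (hP1 : ∑ k, P k = 1) (b : K → ℂ)
    (B : Matrix (Fin d) (Fin d) ℂ) (hB : B = ∑ k, b k • P k) :
    (∑ k, ((‖b k‖ ^ 2 : ℝ) : ℂ) • P k - Bᴴ * B).PosSemidef := by
  have hBH : Bᴴ = ∑ k, star (b k) • P k := by
    rw [hB, Matrix.conjTranspose_sum]
    refine Finset.sum_congr rfl fun k _ => ?_
    rw [Matrix.conjTranspose_smul, (hP k).isHermitian.eq]
  have key : ∑ k, ((‖b k‖ ^ 2 : ℝ) : ℂ) • P k - Bᴴ * B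
      = ∑ k, (b k • 1 - B)ᴴ * P k * (b k • 1 - B) := by
    have h1 : ∀ k, (b k • 1 - B)ᴴ * P k * (b k • 1 - B)
        = ((‖b k‖ ^ 2 : ℝ) : ℂ) • P k - (star (b k) • P k) * B
          - Bᴴ * (b k • P k) + Bᴴ * P k * B := by
      intro k
      have h2 : ((‖b k‖ ^ 2 : ℝ) : ℂ) = b k * star (b k) := by
        rw [Complex.star_def, Complex.mul_conj, Complex.normSq_eq_norm_sq]
      rw [h2]
      simp only [Matrix.conjTranspose_sub, Matrix.conjTranspose_smul, Matrix.conjTranspose_one,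
        Matrix.sub_mul, Matrix.mul_sub, Matrix.smul_mul, Matrix.mul_smul, Matrix.one_mul,
        Matrix.mul_one, smul_smul, smul_sub]
      abel
    simp only [h1, Finset.sum_add_distrib, Finset.sum_sub_distrib]
    rw [← Finset.sum_mul, ← Finset.mul_sum, ← Finset.sum_mul, ← Finset.mul_sum, ← hBH, ← hB, hP1,
      Matrix.mul_one]
    abel
  rw [key]
  exact Matrix.posSemidef_sum _ fun k _ => (hP k).conjTranspose_mul_mul_same _

/-- For a detector with POVM (P_k) and scale a measuring A, and a
density matrix ρ, for every ξ ∈ ℂ^m the statistical mean squared deviation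
Σ_k Tr(ρP_k)‖a_k − ξ‖² is at least the q-expectation Tr(ρ·Σ_j(A_j−ξ_j)ᴴ(A_j−ξ_j));
both sides are real. -/
theorem statistical_ge_quantum_deviation {d : ℕ} {K : Type*} [Fintype K]
    (P : K → Matrix (Fin d) (Fin d) ℂ)
    (hP : ∀ k, (P k).PosSemidef) (hP1 : ∑ k, P k = 1)
    {m : ℕ} (hm : 1 ≤ m) (a : K → Fin m → ℂ)
    (A : Fin m → Matrix (Fin d) (Fin d) ℂ)
    (hA : ∀ j, A j = ∑ k, a k j • P k)
    (ρ : Matrix (Fin d) (Fin d) ℂ) (hρ : ρ.PosSemidef) (hρ1 : ρ.trace = 1)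
    (ξ : Fin m → ℂ) :
    (∀ k, ((ρ * P k).trace).im = 0) ∧
    ((ρ * ∑ j, ((A j - ξ j • 1)ᴴ * (A j - ξ j • 1))).trace).im = 0 ∧
    ∑ k, ((ρ * P k).trace).re * (∑ j, ‖a k j - ξ j‖ ^ 2)
      ≥ ((ρ * ∑ j, ((A j - ξ j • 1)ᴴ * (A j - ξ j • 1))).trace).re := by
  have hBj : ∀ j, A j - ξ j • 1 = ∑ k, (a k j - ξ j) • P k := by
    intro j
    simp only [sub_smul, Finset.sum_sub_distrib]
    rw [← Finset.smul_sum, hP1, hA]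
  refine ⟨fun k => (Complex.nonneg_iff.mp (trace_mul_nonneg_aux hρ (hP k))).2.symm,
    (Complex.nonneg_iff.mp (trace_mul_nonneg_aux hρ (Matrix.posSemidef_sum _ fun j _ =>
      Matrix.posSemidef_conjTranspose_mul_self _))).2.symm, ?_⟩
  have h := fun j => (Complex.nonneg_iff.mp (trace_mul_nonneg_aux hρ
    (kadison_aux P hP hP1 (fun k => a k j - ξ j) _ (hBj j)))).1
  have h' : ∀ j, ((ρ * ((A j - ξ j • 1)ᴴ * (A j - ξ j • 1))).trace).re
      ≤ ∑ k, ((ρ * P k).trace).re * ‖a k j - ξ j‖ ^ 2 := by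
    intro j
    have := h j
    rw [Matrix.mul_sub, Matrix.trace_sub, Complex.sub_re, sub_nonneg] at this
    refine this.trans (le_of_eq ?_)
    rw [Finset.mul_sum, Matrix.trace_sum, Complex.re_sum]
    refine Finset.sum_congr rfl fun k _ => ?_
    rw [Matrix.mul_smul, Matrix.trace_smul, smul_eq_mul, Complex.re_ofReal_mul, mul_comm]
  rw [ge_iff_le, Finset.mul_sum, Matrix.trace_sum, Complex.re_sum]
  simp only [Finset.mul_sum]
  rw [Finset.sum_comm]
  exact Finset.sum_le_sum fun j _ => h' j
end

section
/- Let (P_k)_{k∈K} be a discrete POVM of d×d complex matrices, let m ≥ 1, let a : K → ℂ^m be a scale, define A_j := Σ_{k∈K} (a_k)_j·P_k, and let ρ be a density matrix. Let Ā ∈ ℂ^m have components Ā_j := Tr(ρ·A_j) and let σ_A² := Tr(ρ·Σ_j (A_j − Ā_j·1)ᴴ(A_j − Ā_j·1)). Then Σ_{k∈K} Tr(ρ·P_k)·‖a_k − Ā‖² ≥ σ_A²: the statistical variance of the measurement results is bounded below by the squared q-uncertainty of the measured quantity (Holevo's inequality). -/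
open Matrix BigOperators
open scoped ComplexOrder

theorem holevo_trace_nonneg {d : ℕ} {ρ M : Matrix (Fin d) (Fin d) ℂ}
    (hρ : ρ.PosSemidef) (hM : M.PosSemidef) : 0 ≤ ((ρ * M).trace).re := by
  obtain ⟨R, rfl⟩ : ∃ R : Matrix (Fin d) (Fin d) ℂ, ρ = Rᴴ * R := by
    open scoped MatrixOrder in
    exact CStarAlgebra.nonneg_iff_eq_star_mul_self.mp hρ.nonneg
  have h : (R * M * Rᴴ).PosSemidef := hM.mul_mul_conjTranspose_same R
  have h2 := h.trace_nonneg
  rw [Matrix.mul_assoc, Matrix.trace_mul_comm, Matrix.mul_assoc]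
  rw [Matrix.mul_assoc] at h2
  have h3 := (Complex.le_def.mp h2).1
  simpa [Matrix.mul_assoc] using h3

theorem holevo_aux {d : ℕ} {K : Type*} [Fintype K]
    (P : K → Matrix (Fin d) (Fin d) ℂ)
    (hP : ∀ k, (P k).PosSemidef) (hP1 : ∑ k, P k = 1)
    (ρ : Matrix (Fin d) (Fin d) ℂ) (hρ : ρ.PosSemidef) (c : K → ℂ)
    (B : Matrix (Fin d) (Fin d) ℂ) (hB : B = ∑ k, c k • P k) :
    ((ρ * (Bᴴ * B)).trace).re ≤ ∑ k, ((ρ * P k).trace).re * ‖c k‖ ^ 2 := by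
  have hBH : Bᴴ = ∑ k, star (c k) • P k := by
    rw [hB, Matrix.conjTranspose_sum]
    refine Finset.sum_congr rfl fun k _ => ?_
    rw [Matrix.conjTranspose_smul, (hP k).1.eq]
  have key : ∑ k, (c k • 1 - B)ᴴ * P k * (c k • 1 - B)
      = ∑ k, (star (c k) * c k) • P k - Bᴴ * B := by
    have e : ∀ k, (c k • 1 - B)ᴴ * P k * (c k • 1 - B)
        = (star (c k) * c k) • P k - (star (c k) • P k) * B - Bᴴ * (c k • P k)
          + Bᴴ * P k * B := by
      intro k
      simp only [Matrix.conjTranspose_sub, Matrix.conjTranspose_smul, Matrix.conjTranspose_one,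
        Matrix.sub_mul, Matrix.mul_sub, Matrix.smul_mul, Matrix.mul_smul, Matrix.one_mul,
        Matrix.mul_one, smul_smul, smul_sub]
      rw [mul_comm (c k)]
      abel
    simp only [e, Finset.sum_add_distrib, Finset.sum_sub_distrib]
    rw [← Finset.sum_mul, ← hBH, ← Finset.mul_sum, ← hB, ← Finset.sum_mul, ← Finset.mul_sum, hP1,
      Matrix.mul_one]
    abel
  have hpos : (∑ k, (c k • 1 - B)ᴴ * P k * (c k • 1 - B)).PosSemidef :=
    Matrix.posSemidef_sum _ fun k _ => (hP k).conjTranspose_mul_mul_same _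
  have h := holevo_trace_nonneg hρ hpos
  rw [key, Matrix.mul_sub, Matrix.trace_sub, Complex.sub_re, Finset.mul_sum, Matrix.trace_sum,
    Complex.re_sum] at h
  have e2 : ∀ k, ((ρ * ((star (c k) * c k) • P k)).trace).re
      = ((ρ * P k).trace).re * ‖c k‖ ^ 2 := by
    intro k
    have : star (c k) * c k = ((‖c k‖ ^ 2 : ℝ) : ℂ) := by
      have := Complex.conj_mul' (c k)
      push_cast
      exact this
    rw [this, Matrix.mul_smul, Matrix.trace_smul, smul_eq_mul, Complex.re_ofReal_mul, mul_comm]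
  simp only [e2] at h
  linarith

/-- Holevo's inequality: the statistical variance of the measurement
results of a detector (POVM (P_k) with scale a, measuring A) in a state ρ is
bounded below by the squared q-uncertainty σ_A² of the measured quantity A. -/
theorem holevo_variance_inequality {d : ℕ} {K : Type*} [Fintype K]
    (P : K → Matrix (Fin d) (Fin d) ℂ)
    (hP : ∀ k, (P k).PosSemidef) (hP1 : ∑ k, P k = 1)
    {m : ℕ} (hm : 1 ≤ m) (a : K → Fin m → ℂ)
    (A : Fin m → Matrix (Fin d) (Fin d) ℂ)
    (hA : ∀ j, A j = ∑ k, a k j • P k)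
    (ρ : Matrix (Fin d) (Fin d) ℂ) (hρ : ρ.PosSemidef) (hρ1 : ρ.trace = 1)
    (Abar : Fin m → ℂ) (hAbar : ∀ j, Abar j = (ρ * A j).trace)
    (σA2 : ℝ)
    (hσ : σA2 = ((ρ * ∑ j, ((A j - Abar j • 1)ᴴ * (A j - Abar j • 1))).trace).re) :
    ∑ k, ((ρ * P k).trace).re * (∑ j, ‖a k j - Abar j‖ ^ 2) ≥ σA2 := by
  rw [hσ, Finset.mul_sum, Matrix.trace_sum, Complex.re_sum]
  simp only [Finset.mul_sum]
  rw [Finset.sum_comm]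
  refine Finset.sum_le_sum fun j _ => ?_
  refine holevo_aux P hP hP1 ρ hρ (fun k => a k j - Abar j) _ ?_
  simp only [sub_smul, Finset.sum_sub_distrib]
  rw [← Finset.smul_sum, hP1, hA]
end

section
/- Let (P_k)_{k∈K} be a projective discrete POVM of d×d complex matrices (P_j·P_k = δ_{jk}·P_k for all j, k), let m ≥ 1, let a : K → ℂ^m be a scale with A_j := Σ_{k∈K} (a_k)_j·P_k, and let ρ be a density matrix. Then for every ξ ∈ ℂ^m equality holds in the statistical–quantum variance inequality: Σ_{k∈K} Tr(ρ·P_k)·‖a_k − ξ‖² = Tr(ρ·Σ_j (A_j − ξ_j·1)ᴴ(A_j − ξ_j·1)). -/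
open Matrix BigOperators
open scoped ComplexOrder

/-- For a projective POVM, equality holds in the statistical–quantum
variance inequality: Σ_k Tr(ρP_k)‖a_k − ξ‖² = Tr(ρ·Σ_j(A_j−ξ_j)ᴴ(A_j−ξ_j)). -/
theorem projective_variance_equality {d : ℕ} {K : Type*} [Fintype K] [DecidableEq K]
    (P : K → Matrix (Fin d) (Fin d) ℂ)
    (hP : ∀ k, (P k).PosSemidef) (hP1 : ∑ k, P k = 1)
    (horth : ∀ j k, P j * P k = if j = k then P k else 0)
    {m : ℕ} (hm : 1 ≤ m) (a : K → Fin m → ℂ)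
    (A : Fin m → Matrix (Fin d) (Fin d) ℂ)
    (hA : ∀ j, A j = ∑ k, a k j • P k)
    (ρ : Matrix (Fin d) (Fin d) ℂ) (hρ : ρ.PosSemidef) (hρ1 : ρ.trace = 1)
    (ξ : Fin m → ℂ) :
    ∑ k, ((ρ * P k).trace).re * (∑ j, ‖a k j - ξ j‖ ^ 2)
      = ((ρ * ∑ j, ((A j - ξ j • 1)ᴴ * (A j - ξ j • 1))).trace).re := by
  have h1 : ∀ j, A j - ξ j • (1 : Matrix (Fin d) (Fin d) ℂ) = ∑ k, (a k j - ξ j) • P k := by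
    intro j
    rw [hA, ← hP1, Finset.smul_sum, ← Finset.sum_sub_distrib]
    simp only [sub_smul]
  have h2 : ∀ j, (A j - ξ j • (1 : Matrix (Fin d) (Fin d) ℂ))ᴴ * (A j - ξ j • 1)
      = ∑ k, ((‖a k j - ξ j‖ ^ 2 : ℝ) : ℂ) • P k := by
    intro j
    rw [h1, Matrix.conjTranspose_sum, Finset.sum_mul]
    refine Finset.sum_congr rfl fun k _ => ?_
    rw [Matrix.conjTranspose_smul, (hP k).isHermitian.eq, Finset.mul_sum,
      Finset.sum_eq_single k]
    · rw [smul_mul_smul_comm, horth, if_pos rfl]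
      congr 1
      rw [← Complex.normSq_eq_norm_sq, Complex.normSq_eq_conj_mul_self]
      rfl
    · intro b _ hb
      rw [smul_mul_smul_comm, horth, if_neg (Ne.symm hb), smul_zero]
    · simp
  simp only [h2]
  rw [Finset.sum_comm, Finset.mul_sum, Matrix.trace_sum, Complex.re_sum]
  refine Finset.sum_congr rfl fun k _ => ?_
  rw [← Finset.sum_smul, Matrix.mul_smul, Matrix.trace_smul, ← Complex.ofReal_sum, smul_eq_mul,
    Complex.re_ofReal_mul, mul_comm]
end
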